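/- (Theorem 1, exterior case.) Let occ : ℤ³ → S be an occupancy map, let e be an axis direction, let q ∈ ℤ³, and let r ≥ 1 be an integer. Assume that the voxel q + r·e is a boundary exterior voxel (i.e., a boundary exterior (unknown) voxel or a boundary exterior (occupied) voxel), and that for every integer i with 0 ≤ i < r the voxel q + i·e is not a boundary voxel (so q + r·e is the nearest boundary voxel to q in direction e, at positive distance r). Then occ(q) = unknown. -/

import Mathlib

inductive OccState : Type
  | free | occupied | unknown
deriving DecidableEq

abbrev Voxel := ℤ × ℤ × ℤ

/-- Two voxels are 6-neighbors iff their ℓ¹ distance is 1. -/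
def sixNbr (m n : Voxel) : Prop :=
  |m.1 - n.1| + |m.2.1 - n.2.1| + |m.2.2 - n.2.2| = 1

/-- Boundary interior voxel: free, with a 6-neighbor that is unknown or occupied. -/
def bdInt (occ : Voxel → OccState) (n : Voxel) : Prop :=
  occ n = OccState.free ∧
    ∃ m, sixNbr m n ∧ (occ m = OccState.unknown ∨ occ m = OccState.occupied)

/-- Boundary exterior (unknown) voxel: unknown, with a free 6-neighbor. -/
def bdUkn (occ : Voxel → OccState) (n : Voxel) : Prop :=
  occ n = OccState.unknown ∧ ∃ m, sixNbr m n ∧ occ m = OccState.free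

/-- Boundary exterior (occupied) voxel: any occupied voxel. -/
def bdOcc (occ : Voxel → OccState) (n : Voxel) : Prop :=
  occ n = OccState.occupied

/-- Boundary voxel. -/
def bdVoxel (occ : Voxel → OccState) (n : Voxel) : Prop :=
  bdInt occ n ∨ bdUkn occ n ∨ bdOcc occ n

/-- An axis direction: exactly one nonzero coordinate, equal to ±1 (ℓ¹ norm 1). -/
def axisDir (e : Voxel) : Prop :=
  |e.1| + |e.2.1| + |e.2.2| = 1

theorem sixNbr_add_succ_smul {e : Voxel} (he : axisDir e) (q : Voxel) (i : ℤ) :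
    sixNbr (q + (i + 1) • e) (q + i • e) := by
  have h : q + (i + 1) • e - (q + i • e) = e := by rw [add_smul, one_smul]; abel
  unfold sixNbr
  rwa [← Prod.fst_sub, ← Prod.snd_sub, ← Prod.fst_sub, ← Prod.snd_sub, h]

theorem free_of_sixNbr_of_not_bdVoxel {occ : Voxel → OccState} {m n : Voxel}
    (hn : occ n = OccState.free) (hb : ¬ bdVoxel occ n) (hmn : sixNbr m n) :
    occ m = OccState.free := by
  cases hm : occ m with
  | free => rfl
  | occupied => exact (hb (Or.inl ⟨hn, m, hmn, Or.inr hm⟩)).elim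
  | unknown => exact (hb (Or.inl ⟨hn, m, hmn, Or.inl hm⟩)).elim

theorem stmt3 (occ : Voxel → OccState) (e : Voxel) (he : axisDir e)
    (q : Voxel) (r : ℤ) (hr : 1 ≤ r)
    (hb : bdUkn occ (q + r • e) ∨ bdOcc occ (q + r • e))
    (hnb : ∀ i : ℤ, 0 ≤ i → i < r → ¬ bdVoxel occ (q + i • e)) :
    occ q = OccState.unknown := by
  cases hq : occ q with
  | unknown => rfl
  | occupied =>
    refine (hnb 0 le_rfl (by lia) (Or.inr (Or.inr ?_))).elim
    simpa [bdOcc] using hq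
  | free =>
    have free_ray : ∀ i : ℤ, 0 ≤ i → i ≤ r → occ (q + i • e) = OccState.free := by
      intro i hi
      induction i, hi using Int.leInduction with
      | base => intro _; simpa using hq
      | succ i hi ih =>
        intro hir
        exact free_of_sixNbr_of_not_bdVoxel (ih (by lia)) (hnb i hi (by lia))
          (sixNbr_add_succ_smul he q i)
    have hfree := free_ray r (by lia) le_rfl
    rcases hb with ⟨h, _⟩ | h
    · cases hfree.symm.trans h
    · cases hfree.symm.trans h
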